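/- arXiv:2106.12148 — 2 statements merged into one kernel-verified Lean document; each statement's English description precedes it below -/
import Mathlib

section
/- Every almost self-centered graph of order 10 has girth at most 5, and there exists an almost self-centered graph of order 10 with girth exactly 5. Hence the maximum girth of an almost self-centered graph of order 10 is 5. -/
open SimpleGraph

/-- The eccentricity of a vertex `v`: the maximum distance from `v` to any vertex. -/
noncomputable def graphEcc {V : Type*} [Fintype V] (G : SimpleGraph V) (v : V) : ℕ :=
  Finset.univ.sup fun u => G.dist v u

/-- The radius of a graph: the minimum eccentricity over all vertices. -/
noncomputable def graphRadius {V : Type*} [Fintype V] (G : SimpleGraph V) : ℕ :=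
  sInf (Set.range (graphEcc G))

/-- The diameter of a graph: the maximum eccentricity over all vertices. -/
noncomputable def graphDiam {V : Type*} [Fintype V] (G : SimpleGraph V) : ℕ :=
  Finset.univ.sup (graphEcc G)

/-- A connected graph of order `n` is almost self-centered if it has exactly `n - 2`
central vertices (vertices whose eccentricity equals the radius). -/
def IsAlmostSelfCentered {V : Type*} [Fintype V] (G : SimpleGraph V) : Prop :=
  G.Connected ∧ Nat.card {v : V | graphEcc G v = graphRadius G} = Fintype.card V - 2

/-- A connected graph of order `n` is almost peripheral if it has exactly `n - 1`
peripheral vertices (vertices whose eccentricity equals the diameter). -/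
def IsAlmostPeripheral {V : Type*} [Fintype V] (G : SimpleGraph V) : Prop :=
  G.Connected ∧ Nat.card {v : V | graphEcc G v = graphDiam G} = Fintype.card V - 1

/-! ### The verified search procedure -/

abbrev EL := List (ℕ × ℕ)

/-- `forceN x k = k x`, but makes the kernel evaluate `x` first. -/
noncomputable def forceN {α : Type} (x : ℕ) (k : ℕ → α) : α :=
  Nat.rec (motive := fun _ => α) (k 0) (fun n _ => k (Nat.succ n)) x

theorem forceN_eq {α : Type} (x : ℕ) (k : ℕ → α) : forceN x k = k x := by
  cases x <;> rfl

/-- One step of ball growth in the packed matrix `B` (bit `16 i + j`: `j` is in the ball of `i`). -/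
noncomputable def stepB (o B : ℕ) (E : EL) : ℕ :=
  List.rec (motive := fun _ => ℕ) B (fun e _ acc =>
    Nat.lor (Nat.lor acc (Nat.shiftLeft (Nat.land (Nat.shiftRight B e.1) o) e.2))
      (Nat.shiftLeft (Nat.land (Nat.shiftRight B e.2) o) e.1)) E

/-- Number of full rows. -/
noncomputable def cntB (B : ℕ) (n : ℕ) : ℕ :=
  Nat.rec (motive := fun _ => ℕ) 0 (fun i c =>
    cond (Nat.beq (Nat.mod (Nat.shiftRight B (Nat.mul 16 i)) 65536) 1023) (Nat.succ c) c) n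

/-- Final test: the first nonzero count of full rows is not eight. -/
noncomputable def finB (o : ℕ) (E : EL) (t : ℕ) : ℕ → Bool :=
  Nat.rec (motive := fun _ => ℕ → Bool) (fun _ => false) (fun _ rec B =>
    forceN (cntB B 10) fun c => cond (Nat.beq c 0) (forceN (stepB o B E) rec)
      (cond (Nat.beq c 8) false true)) t

/-- All admissible neighbourhoods of a new vertex `n`. -/
noncomputable def extB (K : EL → Bool) (B n : ℕ) (i : ℕ) : ℕ → EL → Bool → Bool :=
  Nat.rec (motive := fun _ => ℕ → EL → Bool → Bool) (fun _ E ne => cond ne (K E) true)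
   (fun i rec F E ne => cond (rec F E ne)
     (cond (Nat.beq (Nat.land (Nat.shiftRight F i) 1) 1) true
      (forceN (Nat.lor F (Nat.mod (Nat.shiftRight B (Nat.mul 16 i)) 65536))
        fun F' => rec F' ((i, n) :: E) true)) false) i

noncomputable def search (o d t : ℕ) : ℕ → EL → Bool :=
  Nat.rec (motive := fun _ => ℕ → EL → Bool) (fun _ E => finB o E 7 d)
   (fun _ rec n E => forceN (stepB o d E) fun B1 => forceN (stepB o B1 E) fun B2 =>
     forceN (stepB o B2 E) fun B3 => extB (rec (Nat.succ n)) B3 n n 0 E false) t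

/-- bits at multiples of 16 -/
def GoodO (o : ℕ) : Prop := ∀ m, o.testBit m = true ↔ (m % 16 = 0 ∧ m < 160)

def GoodD (d : ℕ) : Prop := ∀ i < 10, ∀ j < 16, (d.testBit (16 * i + j) = true ↔ j = i)

theorem goodO : GoodO 22301085486089920167905467806764065303363585 := by
  intro m
  by_cases h : m < 160
  · revert m; decide +kernel
  · have : Nat.testBit 22301085486089920167905467806764065303363585 m = false := by
      apply Nat.testBit_lt_two_pow
      calc _ < 2 ^ 160 := by norm_num
        _ ≤ 2 ^ m := Nat.pow_le_pow_right (by norm_num) (by omega)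
    simp [this]; omega

theorem goodD : GoodD 11418068654598229877246479150242798270614208513 := by
  unfold GoodD; decide +kernel

theorem shift_bit {o B a b i j : ℕ} (ho : GoodO o) (hb : b < 16) (hi : i < 10)
    (hj : j < 16) :
    (Nat.shiftLeft (Nat.land (Nat.shiftRight B a) o) b).testBit (16 * i + j) = true ↔
      (j = b ∧ B.testBit (16 * i + a) = true) := by
  change (((B >>> a) &&& o) <<< b).testBit (16 * i + j) = true ↔ _
  rw [Nat.testBit_shiftLeft, Nat.testBit_and, Nat.testBit_shiftRight]
  simp only [Bool.and_eq_true, decide_eq_true_eq, ho _]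
  constructor
  · rintro ⟨h1, h2, h3, h4⟩
    have : j = b := by omega
    subst this
    refine ⟨rfl, ?_⟩
    rw [← h2]; congr 1; omega
  · rintro ⟨rfl, h⟩
    refine ⟨by omega, ?_, by omega, by omega⟩
    rw [← h]; congr 1; omega

theorem stepB_iff {o B : ℕ} (ho : GoodO o) {i j : ℕ} (hi : i < 10) (hj : j < 16) (E : EL)
    (hE : ∀ e ∈ E, e.1 < 16 ∧ e.2 < 16) :
    (stepB o B E).testBit (16 * i + j) = true ↔
      (B.testBit (16 * i + j) = true ∨
        ∃ a, B.testBit (16 * i + a) = true ∧ ((a, j) ∈ E ∨ (j, a) ∈ E)) := by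
  induction E with
  | nil => simp [stepB]
  | cons e E ih =>
    have he := hE e (by simp)
    have ih := ih (fun e h => hE e (by simp [h]))
    have : stepB o B (e :: E) = ((stepB o B E) |||
       (Nat.shiftLeft (Nat.land (Nat.shiftRight B e.1) o) e.2)) |||
       (Nat.shiftLeft (Nat.land (Nat.shiftRight B e.2) o) e.1) := rfl
    rw [this, Nat.testBit_or, Nat.testBit_or, Bool.or_eq_true, Bool.or_eq_true, ih,
      shift_bit ho he.2 hi hj, shift_bit ho he.1 hi hj]
    obtain ⟨x, y⟩ := e
    simp only [List.mem_cons, Prod.mk.injEq]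
    constructor
    · rintro (((h | ⟨a, h, h'⟩) | ⟨h, h'⟩) | ⟨h, h'⟩)
      · exact Or.inl h
      · exact Or.inr ⟨a, h, by tauto⟩
      · exact Or.inr ⟨x, h', by tauto⟩
      · exact Or.inr ⟨y, h', by tauto⟩
    · rintro (h | ⟨a, h, (⟨rfl, rfl⟩ | h') | (⟨rfl, rfl⟩ | h')⟩)
      · tauto
      · tauto
      · exact Or.inl (Or.inl (Or.inr ⟨a, h, Or.inl h'⟩))
      · tauto
      · exact Or.inl (Or.inl (Or.inr ⟨a, h, Or.inr h'⟩))

/-- The induced subgraph on `f 0, …, f (n-1)` has edge list `E`. -/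
structure GRep {V : Type} (G : SimpleGraph V) (n : ℕ) (f : ℕ → V) (E : EL) : Prop where
  inj : ∀ a < n, ∀ b < n, f a = f b → a = b
  lt : ∀ e ∈ E, e.1 < n ∧ e.2 < n
  adj : ∀ a < n, ∀ b < n, (G.Adj (f a) (f b) ↔ ((a, b) ∈ E ∨ (b, a) ∈ E))

/-- short walk inside the represented part -/
def WK {V : Type} (G : SimpleGraph V) (n : ℕ) (f : ℕ → V) (k i j : ℕ) : Prop :=
  ∃ p : G.Walk (f i) (f j), p.length ≤ k ∧ ∀ x ∈ p.support, ∃ a < n, x = f a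

def BInv {V : Type} (G : SimpleGraph V) (n : ℕ) (f : ℕ → V) (k B : ℕ) : Prop :=
  ∀ i < n, ∀ j < 16, (B.testBit (16 * i + j) = true ↔ (j < n ∧ WK G n f k i j))

theorem binv_zero {V : Type} {G : SimpleGraph V} {n : ℕ} {f : ℕ → V} {E : EL} {d : ℕ}
    (hR : GRep G n f E) (hn : n ≤ 10) (hd : GoodD d) : BInv G n f 0 d := by
  intro i hi j hj
  rw [hd i (by omega) j hj]
  constructor
  · rintro rfl
    exact ⟨hi, Walk.nil, by simp, by simpa using ⟨j, hi, rfl⟩⟩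
  · rintro ⟨hjn, p, hp, -⟩
    exact (hR.inj i hi j hjn (Walk.eq_of_length_eq_zero (p := p) (by omega))).symm

theorem binv_succ {V : Type} {G : SimpleGraph V} {n : ℕ} {f : ℕ → V} {E : EL} {o k B : ℕ}
    (hR : GRep G n f E) (hn : n ≤ 10) (ho : GoodO o) (hI : BInv G n f k B) :
    BInv G n f (k + 1) (stepB o B E) := by
  intro i hi j hj
  rw [stepB_iff ho (by omega) hj E (fun e he => by have := hR.lt e he; omega)]
  constructor
  · rintro (h | ⟨a, h, h'⟩)
    · obtain ⟨h1, p, hp, hs⟩ := (hI i hi j hj).1 h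
      exact ⟨h1, p, by omega, hs⟩
    · have hlt : a < n ∧ j < n := by
        rcases h' with h' | h' <;> have := hR.lt _ h' <;> simp at this <;> omega
      obtain ⟨h1, p, hp, hs⟩ := (hI i hi a (by omega)).1 h
      have hadj := (hR.adj a hlt.1 j hlt.2).2 h'
      refine ⟨hlt.2, p.concat hadj, by simp; omega, ?_⟩
      intro x hx
      rw [Walk.support_concat] at hx
      simp at hx
      rcases hx with hx | rfl
      · exact hs x hx
      · exact ⟨j, hlt.2, rfl⟩
  · rintro ⟨hjn, p, hp, hs⟩
    by_cases hk : p.length ≤ k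
    · exact Or.inl ((hI i hi j hj).2 ⟨hjn, p, hk, hs⟩)
    · right
      have hnn : ¬ p.Nil := by
        rw [← Walk.length_eq_zero_iff]; omega
      obtain ⟨a, ha, hpa⟩ := hs p.penultimate (by simp [Walk.penultimate, Walk.getVert_mem_support])
      have hadj := p.adj_penultimate hnn
      have hsub : ∀ x ∈ p.dropLast.support, x ∈ p.support := fun x hx =>
        List.dropLast_subset _ (p.support_dropLast hnn ▸ hx)
      have hlen : p.dropLast.length = p.length - 1 := by simp
      refine ⟨a, (hI i hi a (by omega)).2 ⟨ha, p.dropLast.copy rfl hpa, by simp; omega, ?_⟩, ?_⟩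
      · intro x hx
        rw [Walk.support_copy] at hx
        exact hs x (hsub x hx)
      · rw [hpa] at hadj
        exact (hR.adj a ha j hjn).1 hadj

/-- A short detour between two neighbours of `v` gives a short cycle. -/
theorem egirth_le_of_detour {V : Type} {G : SimpleGraph V} {v a b : V} (ha : G.Adj v a)
    (hb : G.Adj v b) (hab : a ≠ b) (p : G.Walk a b) (hv : v ∉ p.support) (k : ℕ)
    (hk : p.length + 2 ≤ k) : G.egirth ≤ (k : ℕ∞) := by
  classical
  have hv' : v ∉ p.bypass.support := fun h => hv (p.support_bypass_subset_support h)
  have hq : (Walk.cons ha p.bypass).IsPath := by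
    rw [Walk.cons_isPath_iff]; exact ⟨p.bypass_isPath, hv'⟩
  have hc : (Walk.cons hb.symm (Walk.cons ha p.bypass)).IsCycle := by
    rw [Walk.cons_isCycle_iff]
    refine ⟨hq, ?_⟩
    rw [Walk.edges_cons, List.mem_cons]
    rintro (h | h)
    · simp only [Sym2.eq_iff] at h
      rcases h with ⟨h1, h2⟩ | ⟨h1, h2⟩
      · exact hb.ne h1.symm
      · exact hab h1.symm
    · exact hv' (Walk.snd_mem_support_of_mem_edges _ h)
  refine (egirth_le_length hc).trans ?_
  have := p.length_bypass_le_length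
  simp only [Walk.length_cons]
  exact_mod_cast (by omega)

theorem extB_sound {K : EL → Bool} {B n : ℕ} (P : ℕ → Prop)
    (hB : ∀ a < n, ∀ b < n, a ≠ b → P a → P b → ¬ B.testBit (16 * a + b) = true) (i : ℕ) :
    i ≤ n → ∀ (F : ℕ) (E : EL) (ne : Bool), extB K B n i F E ne = true →
    (∀ j < i, P j → F.testBit j = false) →
    (ne = true ∨ ∃ j < i, P j) →
    ∃ E' : EL, K E' = true ∧ ∀ e, e ∈ E' ↔ (e ∈ E ∨ ∃ j < i, P j ∧ e = (j, n)) := by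
  induction i with
  | zero =>
    intro _ F E ne h _ hne
    have : ne = true := by simpa using hne
    subst this
    exact ⟨E, h, by simp⟩
  | succ i ih =>
    intro hi F E ne h hF hne
    have h' : cond (extB K B n i F E ne)
     (cond (Nat.beq (Nat.land (Nat.shiftRight F i) 1) 1) true
      (forceN (Nat.lor F (Nat.mod (Nat.shiftRight B (Nat.mul 16 i)) 65536))
        fun F' => extB K B n i F' ((i, n) :: E) true)) false = true := h
    rw [forceN_eq] at h'
    have h1 : extB K B n i F E ne = true := by
      cases hh : extB K B n i F E ne
      · rw [hh] at h'; simp at h'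
      · rfl
    rw [h1, cond_true] at h'
    by_cases hP : P i
    · have hFi := hF i (by omega) hP
      have h2 : Nat.beq (Nat.land (Nat.shiftRight F i) 1) 1 = false := by
        have : Nat.land (Nat.shiftRight F i) 1 = 0 := by
          change F >>> i &&& 1 = 0
          rw [Nat.testBit, Nat.and_comm] at hFi
          simpa using hFi
        rw [this]; rfl
      rw [h2, cond_false] at h'
      obtain ⟨E', hK, hE'⟩ := ih (by omega) _ _ _ h' (by
        intro j hj hPj
        change (F ||| ((B >>> (16 * i)) % 65536)).testBit j = false
        rw [Nat.testBit_or, hF j (by omega) hPj, show 65536 = 2 ^ 16 by norm_num,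
          Nat.testBit_mod_two_pow, Nat.testBit_shiftRight]
        have := hB i (by omega) j (by omega) (by omega) hP hPj
        simp at this
        simp [this]) (Or.inl rfl)
      refine ⟨E', hK, fun e => ?_⟩
      rw [hE', List.mem_cons]
      constructor
      · rintro ((h | h) | ⟨j, hj, hPj, h⟩)
        · exact Or.inr ⟨i, by omega, hP, h⟩
        · exact Or.inl h
        · exact Or.inr ⟨j, by omega, hPj, h⟩
      · rintro (h | ⟨j, hj, hPj, h⟩)
        · tauto
        · rcases Nat.lt_succ_iff_lt_or_eq.1 hj with hj | rfl
          · exact Or.inr ⟨j, hj, hPj, h⟩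
          · tauto
    · have key : ∀ j, (j < i + 1 ∧ P j) ↔ (j < i ∧ P j) := by
        intro j
        constructor
        · rintro ⟨h, hj⟩
          have : j ≠ i := by rintro rfl; exact hP hj
          exact ⟨by omega, hj⟩
        · rintro ⟨h, hj⟩; exact ⟨by omega, hj⟩
      obtain ⟨E', hK, hE'⟩ := ih (by omega) _ _ _ h1 (fun j hj => hF j (by omega)) (by
        rcases hne with h | ⟨j, hj⟩
        · exact Or.inl h
        · exact Or.inr ⟨j, (key j).1 hj⟩)
      refine ⟨E', hK, fun e => ?_⟩
      rw [hE']
      simp only [← and_assoc, key]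

section Final

variable {V : Type} [Fintype V] {G : SimpleGraph V} {f : ℕ → V} {E : EL}

theorem graphRadius_le (v : V) : graphRadius G ≤ graphEcc G v := Nat.sInf_le ⟨v, rfl⟩

theorem GRep.surj (hV : Fintype.card V = 10) (hR : GRep G 10 f E) (v : V) : ∃ i < 10, f i = v := by
  have hinj : Function.Injective (fun i : Fin 10 => f i) := fun a b h =>
    Fin.ext (hR.inj a a.2 b b.2 h)
  have hb := (Fintype.bijective_iff_injective_and_card _).2 ⟨hinj, by simp [hV]⟩
  obtain ⟨i, hi⟩ := hb.2 v
  exact ⟨i, i.2, hi⟩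

theorem WK_iff (hV : Fintype.card V = 10) (hc : G.Connected) (hR : GRep G 10 f E) (k i j : ℕ) :
    WK G 10 f k i j ↔ G.dist (f i) (f j) ≤ k := by
  constructor
  · rintro ⟨p, hp, -⟩
    exact (dist_le p).trans hp
  · intro h
    obtain ⟨p, hp⟩ := hc.exists_walk_length_eq_dist (f i) (f j)
    refine ⟨p, by omega, fun x _ => ?_⟩
    obtain ⟨a, ha, h⟩ := hR.surj hV x
    exact ⟨a, ha, h.symm⟩

theorem row_full (hV : Fintype.card V = 10) (hc : G.Connected) (hR : GRep G 10 f E) {k B : ℕ}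
    (hI : BInv G 10 f k B) {i : ℕ} (hi : i < 10) :
    Nat.beq (Nat.mod (Nat.shiftRight B (Nat.mul 16 i)) 65536) 1023 = true ↔
      graphEcc G (f i) ≤ k := by
  change Nat.beq ((B >>> (16 * i)) % 2 ^ 16) 1023 = true ↔ _
  have e1 : ∀ j, Nat.testBit 1023 j = decide (j < 10) := by
    intro j
    have := Nat.testBit_two_pow_sub_one 10 j
    simpa using this
  rw [Nat.beq_eq, graphEcc, Finset.sup_le_iff]
  constructor
  · intro h u _
    obtain ⟨j, hj, rfl⟩ := hR.surj hV u
    rw [← WK_iff hV hc hR]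
    refine ((hI i hi j (by omega)).1 ?_).2
    have := congrArg (fun x => x.testBit j) h
    simp only [Nat.testBit_mod_two_pow, Nat.testBit_shiftRight, e1] at this
    simpa [hj, show j < 16 by omega] using this
  · intro h
    apply Nat.eq_of_testBit_eq
    intro j
    rw [Nat.testBit_mod_two_pow, Nat.testBit_shiftRight, e1]
    by_cases hj : j < 16
    · have := hI i hi j hj
      rw [WK_iff hV hc hR] at this
      have h3 := h (f j) (Finset.mem_univ _)
      rw [Bool.eq_iff_iff]
      simp [hj, this, h3]
    · have : ¬ j < 10 := by omega
      simp [hj, this]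

theorem cntB_eq (hV : Fintype.card V = 10) (hc : G.Connected) (hR : GRep G 10 f E) {k B : ℕ}
    (hI : BInv G 10 f k B) (n : ℕ) (hn : n ≤ 10) :
    cntB B n = ((Finset.range n).filter (fun i => graphEcc G (f i) ≤ k)).card := by
  induction n with
  | zero => rfl
  | succ n ih =>
    have : cntB B (n + 1) = cond (Nat.beq (Nat.mod (Nat.shiftRight B (Nat.mul 16 n)) 65536) 1023)
      (Nat.succ (cntB B n)) (cntB B n) := rfl
    rw [this, Finset.range_add_one, Finset.filter_insert, ih (by omega)]
    have hr := row_full hV hc hR hI (i := n) (by omega)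
    by_cases h : graphEcc G (f n) ≤ k
    · rw [hr.2 h, if_pos h, Finset.card_insert_of_notMem (by simp)]; rfl
    · rw [if_neg h]
      rw [← hr, Bool.not_eq_true] at h
      rw [h]; rfl

/-- the first nonzero count is the number of central vertices -/
theorem card_central (hV : Fintype.card V = 10) (hc : G.Connected) (hR : GRep G 10 f E) {k B : ℕ}
    (hI : BInv G 10 f k B) (hk : ∀ v, k ≤ graphEcc G v) (h0 : cntB B 10 ≠ 0) :
    Nat.card {v : V | graphEcc G v = graphRadius G} = cntB B 10 := by
  have hcnt := cntB_eq hV hc hR hI 10 le_rfl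
  have hr : graphRadius G = k := by
    rw [hcnt] at h0
    obtain ⟨i, hi⟩ := Finset.card_pos.1 (Nat.pos_of_ne_zero h0)
    rw [Finset.mem_filter] at hi
    apply le_antisymm ((graphRadius_le (f i)).trans hi.2)
    exact le_csInf ⟨_, f i, rfl⟩ (by rintro _ ⟨v, rfl⟩; exact hk v)
  rw [hcnt, hr]
  have : {v : V | graphEcc G v = k} =
      f '' ((Finset.range 10).filter (fun i => graphEcc G (f i) ≤ k) : Finset ℕ) := by
    ext v
    simp only [Set.mem_ofPred_eq, Set.mem_image, Finset.mem_coe, Finset.mem_filter,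
      Finset.mem_range]
    constructor
    · intro h
      obtain ⟨i, hi, rfl⟩ := hR.surj hV v
      exact ⟨i, ⟨hi, h.le⟩, rfl⟩
    · rintro ⟨i, ⟨hi, h⟩, rfl⟩
      exact le_antisymm h (hk _)
  rw [this, Nat.card_coe_set_eq, Set.InjOn.ncard_image, Set.ncard_coe_finset]
  intro a ha b hb h
  simp only [Finset.mem_coe, Finset.mem_filter, Finset.mem_range] at ha hb
  exact hR.inj a ha.1 b hb.1 h

theorem level_succ (hV : Fintype.card V = 10) (hc : G.Connected) (hR : GRep G 10 f E) {k B : ℕ}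
    (hI : BInv G 10 f k B) (h0 : cntB B 10 = 0) (v : V) : k + 1 ≤ graphEcc G v := by
  rw [cntB_eq hV hc hR hI 10 le_rfl, Finset.card_eq_zero] at h0
  obtain ⟨i, hi, rfl⟩ := hR.surj hV v
  by_contra h
  have : i ∈ (Finset.range 10).filter (fun i => graphEcc G (f i) ≤ k) := by
    simp [hi]; omega
  rw [h0] at this; simp at this

theorem finB_sound (hV : Fintype.card V = 10) (hc : G.Connected) (hR : GRep G 10 f E) {o : ℕ}
    (ho : GoodO o) (t : ℕ) : ∀ k B, BInv G 10 f k B → (∀ v, k ≤ graphEcc G v) →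
      finB o E t B = true → ¬ IsAlmostSelfCentered G := by
  induction t with
  | zero => intro k B _ _ h; simp [finB] at h
  | succ t ih =>
    intro k B hI hk h
    have h' : (forceN (cntB B 10) fun c => cond (Nat.beq c 0) (forceN (stepB o B E) (finB o E t))
      (cond (Nat.beq c 8) false true)) = true := h
    rw [forceN_eq, forceN_eq] at h'
    by_cases h0 : cntB B 10 = 0
    · rw [h0] at h'
      exact ih (k + 1) _ (binv_succ hR le_rfl ho hI) (level_succ hV hc hR hI h0) h'
    · intro hA
      have h8 := hA.2
      rw [card_central hV hc hR hI hk h0, hV] at h8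
      rw [h8] at h'
      simp at h'

theorem search_sound (hV : Fintype.card V = 10) (hc : G.Connected) (hg : ¬ G.egirth ≤ (5 : ℕ∞))
    {o d : ℕ} (ho : GoodO o) (hd : GoodD d) (t : ℕ) :
    ∀ n (f : ℕ → V) (E : EL), GRep G n f E → n + t = 10 → 0 < n →
      search o d t n E = true → ¬ IsAlmostSelfCentered G := by
  induction t with
  | zero =>
    intro n f E hR hn _ h
    obtain rfl : n = 10 := by omega
    exact finB_sound hV hc hR ho 7 0 d (binv_zero hR le_rfl hd) (by simp) h
  | succ t ih =>
    intro n f E hR hn hpos h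
    have h' : (forceN (stepB o d E) fun B1 => forceN (stepB o B1 E) fun B2 =>
     forceN (stepB o B2 E) fun B3 => extB (search o d t (Nat.succ n)) B3 n n 0 E false) = true := h
    simp only [forceN_eq] at h'
    have hI := binv_succ hR (by omega) ho (binv_succ hR (by omega) ho
      (binv_succ hR (by omega) ho (binv_zero hR (by omega) hd)))
    -- a new vertex adjacent to the represented part
    obtain ⟨v, hv, hadj⟩ : ∃ v, (∀ i < n, f i ≠ v) ∧ ∃ i < n, G.Adj v (f i) := by
      obtain ⟨y, hy⟩ : ∃ y, ∀ i < n, f i ≠ y := by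
        by_contra hcon
        push Not at hcon
        have hs : Function.Surjective (fun i : Fin n => f i) := fun y => by
          obtain ⟨i, hi, h⟩ := hcon y
          exact ⟨⟨i, hi⟩, h⟩
        have := Fintype.card_le_of_surjective _ hs
        simp [hV] at this; omega
      obtain ⟨p⟩ := hc.preconnected (f 0) y
      obtain ⟨e, he, h1, h2⟩ := p.exists_boundary_dart {x | ∃ i < n, f i = x} ⟨0, hpos, rfl⟩
        (by rintro ⟨i, hi, h⟩; exact hy i hi h)
      obtain ⟨i, hi, h⟩ := h1
      refine ⟨e.snd, fun i hi h => h2 ⟨i, hi, h⟩, i, hi, ?_⟩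
      rw [h]; exact e.adj.symm
    obtain ⟨E', hK, hE'⟩ := extB_sound (fun i => G.Adj v (f i)) (by
        intro a ha b hb hab hPa hPb hbit
        obtain ⟨-, p, hp, hs⟩ := (hI a ha b (by omega)).1 hbit
        apply hg
        refine egirth_le_of_detour hPa hPb (fun h => hab (hR.inj a ha b hb h)) p ?_ 5 (by omega)
        intro hvs
        obtain ⟨i, hi, h⟩ := hs v hvs
        exact hv i hi h.symm) n le_rfl 0 E false h' (by simp) (Or.inr hadj)
    refine ih (n + 1) (fun i => if i < n then f i else v) E' ?_ (by omega) (by omega) hK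
    constructor
    · intro a ha b hb hab
      by_cases h1 : a < n <;> by_cases h2 : b < n <;> simp only [h1, h2, if_true, if_false] at hab
      · exact hR.inj a h1 b h2 hab
      · exact (hv a h1 hab).elim
      · exact (hv b h2 hab.symm).elim
      · omega
    · intro e he
      rcases (hE' e).1 he with h | ⟨j, hj, -, rfl⟩
      · have := hR.lt e h; omega
      · simp; omega
    · intro a ha b hb
      have nE : ∀ x y, (x, y) ∈ E → x < n ∧ y < n := fun x y h => hR.lt _ h
      simp only [hE', Prod.mk.injEq]
      by_cases h1 : a < n <;> by_cases h2 : b < n <;> simp only [h1, h2, if_true, if_false]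
      · rw [hR.adj a h1 b h2]
        constructor
        · tauto
        · rintro ((h | ⟨j, _, _, _, h⟩) | (h | ⟨j, _, _, _, h⟩))
          · tauto
          · omega
          · tauto
          · omega
      · obtain rfl : b = n := by omega
        rw [G.adj_comm]
        constructor
        · intro h; exact Or.inl (Or.inr ⟨a, h1, h, rfl, rfl⟩)
        · rintro ((h | ⟨j, _, h, rfl, _⟩) | (h | ⟨j, _, _, _, h⟩))
          · have := nE _ _ h; omega
          · exact h
          · have := nE _ _ h; omega
          · omega
      · obtain rfl : a = n := by omega
        constructor
        · intro h; exact Or.inr (Or.inr ⟨b, h2, h, rfl, rfl⟩)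
        · rintro ((h | ⟨j, _, _, _, h⟩) | (h | ⟨j, _, h, rfl, _⟩))
          · have := nE _ _ h; omega
          · omega
          · have := nE _ _ h; omega
          · exact h
      · obtain rfl : a = n := by omega
        obtain rfl : b = a := by omega
        constructor
        · intro h; exact (G.irrefl h).elim
        · rintro ((h | ⟨j, _, _, _, h⟩) | (h | ⟨j, _, h, rfl, _⟩))
          · have := nE _ _ h; omega
          · omega
          · have := nE _ _ h; omega
          · omega

end Final

/-! ### The acyclic case -/

theorem acyclic_two_nearer {V : Type} {G : SimpleGraph V} (hc : G.Connected) (hA : G.IsAcyclic)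
    {v a b p : V} (ha : G.Adj v a) (hb : G.Adj v b) (hpa : G.dist a p ≤ G.dist v p)
    (hpb : G.dist b p ≤ G.dist v p) : a = b := by
  classical
  have key : ∀ {x : V} (hx : G.Adj v x), G.dist x p ≤ G.dist v p →
      ∃ q : G.Walk x p, (Walk.cons hx q).IsPath := by
    intro x hx hd
    obtain ⟨q, hq, hl⟩ := hc.exists_path_of_dist x p
    refine ⟨q, ?_⟩
    rw [Walk.cons_isPath_iff]
    refine ⟨hq, fun hv => ?_⟩
    have h1 := congrArg Walk.length (q.take_spec hv)
    rw [Walk.length_append] at h1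
    have h2 := dist_le (q.dropUntil v hv)
    have h3 := dist_le (q.takeUntil v hv)
    rw [dist_eq_one_iff_adj.2 hx.symm] at h3
    omega
  obtain ⟨q1, h1⟩ := key ha hpa
  obtain ⟨q2, h2⟩ := key hb hpb
  have := hA.path_unique ⟨_, h1⟩ ⟨_, h2⟩
  have h3 := congrArg (fun w : G.Path v p => w.1.getVert 1) this
  simpa using h3

theorem acyclic_not_asc {V : Type} [Fintype V] {G : SimpleGraph V} (hV : Fintype.card V = 10)
    (hA : G.IsAcyclic) : ¬ IsAlmostSelfCentered G := by
  classical
  rintro ⟨hc, hcard⟩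
  set C : Finset V := Finset.univ.filter (fun v => graphEcc G v = graphRadius G) with hC
  have hC8 : C.card = 8 := by
    rw [hV, Nat.card_coe_set_eq] at hcard
    rw [← Set.ncard_coe_finset, hC]
    simpa using hcard
  have hX2 : Cᶜ.card = 2 := by rw [Finset.card_compl, hV, hC8]
  have h1 : ∀ v, (C.filter (fun u => G.Adj v u)).card ≤ 1 := by
    intro v
    rw [Finset.card_le_one]
    intro a ha b hb
    simp only [hC, Finset.mem_filter, Finset.mem_univ, true_and] at ha hb
    haveI : Nonempty V := ⟨v⟩
    obtain ⟨p, -, hp⟩ := Finset.exists_mem_eq_sup (Finset.univ : Finset V)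
      Finset.univ_nonempty (fun u => G.dist v u)
    have hr : graphRadius G ≤ G.dist v p := by
      have := graphRadius_le (G := G) v
      rw [graphEcc, hp] at this
      exact this
    have hle : ∀ x, G.dist x p ≤ graphEcc G x := fun x =>
      Finset.le_sup (f := fun u => G.dist x u) (Finset.mem_univ p)
    exact acyclic_two_nearer hc hA ha.2 hb.2 (((hle a).trans ha.1.le).trans hr)
      (((hle b).trans hb.1.le).trans hr)
  have hsplit : ∀ v, G.degree v = (C.filter (fun u => G.Adj v u)).card +
      (Cᶜ.filter (fun u => G.Adj v u)).card := by
    intro v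
    rw [← G.card_neighborFinset_eq_degree, ← Finset.card_union_of_disjoint]
    · congr 1
      ext u
      by_cases hu : u ∈ C <;> simp [hu]
    · exact Finset.disjoint_filter_filter disjoint_compl_right
  have hX : ∀ x ∈ Cᶜ, G.degree x ≤ 2 := by
    intro x hx
    have : (Cᶜ.filter (fun u => G.Adj x u)).card ≤ 1 := by
      have : Cᶜ.filter (fun u => G.Adj x u) ⊆ Cᶜ.erase x := by
        intro u hu
        rw [Finset.mem_filter] at hu
        exact Finset.mem_erase.2 ⟨hu.2.ne', hu.1⟩
      have := Finset.card_le_card this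
      rw [Finset.card_erase_of_mem hx, hX2] at this
      exact this
    have := h1 x
    rw [hsplit]; omega
  have hdc : ∑ v, (Cᶜ.filter (fun u => G.Adj v u)).card = ∑ x ∈ Cᶜ, G.degree x := by
    simp only [Finset.card_filter]
    rw [Finset.sum_comm]
    apply Finset.sum_congr rfl
    intro x _
    rw [← Finset.card_filter, ← G.card_neighborFinset_eq_degree]
    congr 1
    ext u
    simp [G.adj_comm]
  have hs : ∑ v, G.degree v ≤ 14 := by
    rw [Finset.sum_congr rfl (fun v _ => hsplit v), Finset.sum_add_distrib, hdc]
    have a1 := Finset.sum_le_card_nsmul Finset.univ _ 1 (fun v _ => h1 v)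
    have a2 := Finset.sum_le_card_nsmul Cᶜ _ 2 hX
    rw [Finset.card_univ, hV] at a1
    rw [hX2] at a2
    simp only [smul_eq_mul] at a1 a2
    omega
  have ht : G.IsTree := ⟨hc, hA⟩
  have := ht.card_edgeFinset
  rw [G.sum_degrees_eq_twice_card_edges] at hs
  omega

/-! ### The cyclic case -/

def cyc (g : ℕ) : EL := (0, g - 1) :: (List.range (g - 1)).map (fun i => (i, i + 1))

theorem mem_cyc (g a b : ℕ) :
    (a, b) ∈ cyc g ↔ ((a = 0 ∧ b = g - 1) ∨ (b = a + 1 ∧ a < g - 1)) := by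
  simp only [cyc, List.mem_cons, Prod.mk.injEq, List.mem_map, List.mem_range]
  constructor
  · rintro (h | ⟨i, h, rfl, rfl⟩)
    · exact Or.inl h
    · exact Or.inr ⟨rfl, h⟩
  · rintro (h | ⟨rfl, h⟩)
    · exact Or.inl h
    · exact Or.inr ⟨a, h, rfl, rfl⟩

theorem along {V : Type} {G : SimpleGraph V} {f : ℕ → V} {g : ℕ}
    (hf : ∀ k < g, G.Adj (f k) (f (k + 1))) (i m : ℕ) (h : i + m ≤ g) :
    ∃ p : G.Walk (f i) (f (i + m)), p.length = m ∧
      ∀ x ∈ p.support, ∃ a, i ≤ a ∧ a ≤ i + m ∧ x = f a := by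
  induction m with
  | zero => exact ⟨Walk.nil, rfl, by simpa using ⟨i, le_rfl, le_rfl, rfl⟩⟩
  | succ m ih =>
    obtain ⟨p, hp, hs⟩ := ih (by omega)
    refine ⟨p.concat (hf (i + m) (by omega)), by simp [hp], ?_⟩
    intro x hx
    rw [Walk.support_concat] at hx
    simp at hx
    rcases hx with hx | rfl
    · obtain ⟨a, h1, h2, h3⟩ := hs x hx
      exact ⟨a, h1, by omega, h3⟩
    · exact ⟨i + m + 1, by omega, by omega, rfl⟩

theorem cycle_rep {V : Type} {G : SimpleGraph V} {f : ℕ → V} {g : ℕ} (h3 : 3 ≤ g)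
    (hg : G.egirth = (g : ℕ∞))
    (hf : ∀ k < g, G.Adj (f k) (f (k + 1))) (hfg : f g = f 0)
    (hinj : ∀ a < g, ∀ b < g, f a = f b → a = b) : GRep G g f (cyc g) := by
  have hlast : G.Adj (f 0) (f (g - 1)) := by
    have := hf (g - 1) (by omega)
    rw [show g - 1 + 1 = g by omega, hfg] at this
    exact this.symm
  have chord : ∀ i j, i < j → j < g → G.Adj (f i) (f j) →
      ((i = 0 ∧ j = g - 1) ∨ (j = i + 1 ∧ i < g - 1)) := by
    intro i j hij hj hadj
    by_contra hcon
    obtain ⟨m, rfl⟩ : ∃ m, j = i + m + 2 := ⟨j - i - 2, by omega⟩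
    obtain ⟨p, hp, hs⟩ := along hf i (m + 1) (by omega)
    have := egirth_le_of_detour hadj.symm (hf (i + (m + 1)) (by omega)).symm
      (fun h => by have := hinj _ (by omega) _ (by omega) h; omega) p (by
        intro hv
        obtain ⟨a, h1, h2, h4⟩ := hs _ hv
        have := hinj _ (by omega) _ (by omega) h4
        omega) (m + 3) (by omega)
    rw [hg] at this
    have : g ≤ m + 3 := by exact_mod_cast this
    omega
  refine ⟨hinj, ?_, ?_⟩
  · rintro ⟨a, b⟩ he
    rw [mem_cyc] at he
    simp only
    omega
  · intro a ha b hb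
    rw [mem_cyc, mem_cyc]
    constructor
    · intro h
      rcases lt_trichotomy a b with hab | rfl | hab
      · exact Or.inl (chord a b hab hb h)
      · exact (G.irrefl h).elim
      · exact Or.inr (chord b a hab ha h.symm)
    · rintro ((⟨rfl, rfl⟩ | ⟨rfl, h⟩) | (⟨rfl, rfl⟩ | ⟨rfl, h⟩))
      · exact hlast
      · exact hf a (by omega)
      · exact hlast.symm
      · exact (hf b (by omega)).symm

theorem cycle_rep_succ {V : Type} {G : SimpleGraph V} {f : ℕ → V} {g : ℕ} (h5 : 5 ≤ g)
    (hg : G.egirth = (g : ℕ∞))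
    (hf : ∀ k < g, G.Adj (f k) (f (k + 1))) (hfg : f g = f 0)
    (hinj : ∀ a < g, ∀ b < g, f a = f b → a = b) {v : V} (hv : ∀ i < g, f i ≠ v)
    (hadj : G.Adj v (f 0)) :
    GRep G (g + 1) (fun i => if i < g then f i else v) ((0, g) :: cyc g) := by
  have hR := cycle_rep (by omega) hg hf hfg hinj
  have hv' : ∀ i ≤ g, v ≠ f i := by
    intro i hi h
    rcases hi.lt_or_eq with hi | rfl
    · exact hv i hi h.symm
    · exact hv 0 (by omega) (by rw [h, hfg])
  have honly : ∀ i < g, G.Adj v (f i) → i = 0 := by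
    intro i hi ha
    by_contra h0
    have hne : f 0 ≠ f i := fun h => h0 (hinj _ (by omega) _ hi h).symm
    obtain ⟨p, hp, hs⟩ := along hf 0 i (by omega)
    obtain ⟨q, hq, ht⟩ := along hf i (g - i) (by omega)
    rw [zero_add] at p
    have e1 := along hf 0 i (by omega)
    rw [zero_add] at e1
    obtain ⟨p, hp, hs⟩ := e1
    have e2 := along hf i (g - i) (by omega)
    rw [show i + (g - i) = g by omega, hfg] at e2
    obtain ⟨q, hq, ht⟩ := e2
    have b1 := egirth_le_of_detour hadj ha hne p (by
      intro h
      obtain ⟨a, _, h2, h4⟩ := hs _ h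
      exact hv' a (by omega) h4) (i + 2) (by omega)
    have b2 := egirth_le_of_detour ha hadj hne.symm q (by
      intro h
      obtain ⟨a, _, h2, h4⟩ := ht _ h
      exact hv' a (by omega) h4) (g - i + 2) (by omega)
    rw [hg] at b1 b2
    have b1 : g ≤ i + 2 := by exact_mod_cast b1
    have b2 : g ≤ g - i + 2 := by exact_mod_cast b2
    omega
  have nE : ∀ x y, (x, y) ∈ cyc g → x < g ∧ y < g := fun x y h => hR.lt _ h
  constructor
  · intro a ha b hb hab
    by_cases h1 : a < g <;> by_cases h2 : b < g <;> simp only [h1, h2, if_true, if_false] at hab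
    · exact hinj a h1 b h2 hab
    · exact (hv a h1 hab).elim
    · exact (hv b h2 hab.symm).elim
    · omega
  · intro e he
    rcases List.mem_cons.1 he with rfl | h
    · simp
    · have := hR.lt e h; omega
  · intro a ha b hb
    simp only [List.mem_cons, Prod.mk.injEq]
    by_cases h1 : a < g <;> by_cases h2 : b < g <;> simp only [h1, h2, if_true, if_false]
    · rw [hR.adj a h1 b h2]
      constructor
      · tauto
      · rintro ((h | h) | (h | h))
        · omega
        · tauto
        · omega
        · tauto
    · obtain rfl : b = g := by omega
      rw [G.adj_comm]
      constructor
      · intro h; exact Or.inl (Or.inl ⟨honly a h1 h, rfl⟩)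
      · rintro ((⟨rfl, _⟩ | h) | (h | h))
        · exact hadj
        · have := nE _ _ h; omega
        · omega
        · have := nE _ _ h; omega
    · obtain rfl : a = g := by omega
      constructor
      · intro h; exact Or.inr (Or.inl ⟨honly b h2 h, rfl⟩)
      · rintro ((h | h) | (⟨rfl, _⟩ | h))
        · omega
        · have := nE _ _ h; omega
        · exact hadj
        · have := nE _ _ h; omega
    · obtain rfl : a = g := by omega
      obtain rfl : b = a := by omega
      constructor
      · intro h; exact (G.irrefl h).elim
      · rintro ((h | h) | (h | h))
        · omega
        · have := nE _ _ h; omega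
        · omega
        · have := nE _ _ h; omega

theorem search_six : search 22301085486089920167905467806764065303363585
    11418068654598229877246479150242798270614208513 3 7 ((0, 6) :: cyc 6) = true := by
  decide +kernel

theorem search_seven : search 22301085486089920167905467806764065303363585
    11418068654598229877246479150242798270614208513 2 8 ((0, 7) :: cyc 7) = true := by
  decide +kernel

theorem search_eight : search 22301085486089920167905467806764065303363585
    11418068654598229877246479150242798270614208513 1 9 ((0, 8) :: cyc 8) = true := by
  decide +kernel

theorem search_nine : search 22301085486089920167905467806764065303363585
    11418068654598229877246479150242798270614208513 0 10 ((0, 9) :: cyc 9) = true := by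
  decide +kernel

theorem search_ten : search 22301085486089920167905467806764065303363585
    11418068654598229877246479150242798270614208513 0 10 (cyc 10) = true := by
  decide +kernel

theorem upper_bound (V : Type) [Fintype V] (G : SimpleGraph V) (hV : Fintype.card V = 10)
    (hS : IsAlmostSelfCentered G) : G.egirth ≤ (5 : ℕ∞) := by
  classical
  by_contra hg
  have hc := hS.1
  by_cases hA : G.IsAcyclic
  · exact acyclic_not_asc hV hA hS
  obtain ⟨a, w, hw, hgw⟩ := exists_egirth_eq_length.2 hA
  have hinj' : ∀ {x : V} (u : G.Walk x x), u.IsCycle →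
      ∀ a < u.length, ∀ b < u.length, u.getVert a = u.getVert b → a = b := by
    intro x u hu a ha b hb h
    exact hu.getVert_injOn' (by simp only [Set.mem_ofPred_eq]; omega)
      (by simp only [Set.mem_ofPred_eq]; omega) h
  have hstep : ∀ {x : V} (u : G.Walk x x), ∀ k < u.length,
      G.Adj (u.getVert k) (u.getVert (k + 1)) := fun u k hk => u.adj_getVert_succ hk
  have h6 : 6 ≤ w.length := by
    by_contra h
    apply hg
    rw [hgw]
    exact_mod_cast (by omega : w.length ≤ 5)
  have h10 : w.length ≤ 10 := by
    have hi : Function.Injective (fun i : Fin w.length => w.getVert i) := fun a b h =>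
      Fin.ext (hinj' w hw a a.2 b b.2 h)
    have := Fintype.card_le_of_injective _ hi
    simpa [hV] using this
  rcases h10.eq_or_lt with h10 | h10
  · have hR := cycle_rep (f := w.getVert) (by omega) hgw (hstep w) (by simp) (hinj' w hw)
    rw [h10] at hR
    exact search_sound hV hc hg goodO goodD 0 10 _ _ hR rfl (by omega) search_ten hS
  · obtain ⟨v, u, hv, hu, hadj⟩ : ∃ v u, v ∉ w.support ∧ u ∈ w.support ∧ G.Adj v u := by
      obtain ⟨y, hy⟩ : ∃ y, y ∉ w.support := by
        by_contra hcon
        push Not at hcon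
        have hs : Function.Surjective (fun i : Fin w.length => w.getVert i) := fun y => by
          obtain ⟨i, h, hi⟩ := Walk.mem_support_iff_exists_getVert.1 (hcon y)
          rcases hi.eq_or_lt with rfl | hi
          · exact ⟨⟨0, by omega⟩, by simpa using h⟩
          · exact ⟨⟨i, hi⟩, h⟩
        have := Fintype.card_le_of_surjective _ hs
        simp [hV] at this; omega
      obtain ⟨p⟩ := hc.preconnected a y
      obtain ⟨e, he, h1, h2⟩ := p.exists_boundary_dart {x | x ∈ w.support} w.start_mem_support hy
      exact ⟨e.snd, e.fst, h2, h1, e.adj.symm⟩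
    have hw' := hw.rotate hu
    have hlen : (w.rotate u hu).length = w.length := by simp
    have hR := cycle_rep_succ (f := (w.rotate u hu).getVert) (g := (w.rotate u hu).length)
      (v := v) (by omega)
      (by rw [hlen]; exact hgw) (hstep _) (by rw [Walk.getVert_length, Walk.getVert_zero]) (hinj' _ hw') (by
        intro i hi h
        apply hv
        rw [← Walk.mem_support_rotate_iff w u hu, ← h]
        exact Walk.getVert_mem_support _ _) (by simpa using hadj)
    rw [hlen] at hR
    generalize w.length = g at *
    interval_cases g
    · exact search_sound hV hc hg goodO goodD 3 7 _ _ hR rfl (by omega) search_six hS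
    · exact search_sound hV hc hg goodO goodD 2 8 _ _ hR rfl (by omega) search_seven hS
    · exact search_sound hV hc hg goodO goodD 1 9 _ _ hR rfl (by omega) search_eight hS
    · exact search_sound hV hc hg goodO goodD 0 10 _ _ hR rfl (by omega) search_nine hS

/-! ### The example of girth five -/

def exE : EL := [(0, 1), (0, 4), (1, 2), (1, 5), (1, 6), (2, 3), (3, 4), (4, 8), (4, 9), (5, 9),
  (6, 7), (7, 9)]

def exG : SimpleGraph (Fin 10) where
  Adj a b := (a.1, b.1) ∈ exE ∨ (b.1, a.1) ∈ exE
  symm := ⟨fun _ _ h => h.symm⟩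
  loopless := ⟨by decide⟩

instance : DecidableRel exG.Adj := fun a b =>
  inferInstanceAs (Decidable ((a.1, b.1) ∈ exE ∨ (b.1, a.1) ∈ exE))

theorem exG_rep : GRep exG 10 (fun i => Fin.ofNat 10 i) exE := by
  constructor
  · decide
  · decide
  · intro a ha b hb
    change ((a % 10, b % 10) ∈ exE ∨ (b % 10, a % 10) ∈ exE) ↔ _
    rw [Nat.mod_eq_of_lt ha, Nat.mod_eq_of_lt hb]

theorem exG_connected : exG.Connected := by
  have h : ∀ v : Fin 10, exG.Reachable v 0 := by
    have step : ∀ a b : Fin 10, exG.Adj a b → exG.Reachable b 0 → exG.Reachable a 0 :=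
      fun a b h h' => h.reachable.trans h'
    have h0 : exG.Reachable 0 0 := Reachable.refl _
    have h1 := step 1 0 (by decide) h0
    have h4 := step 4 0 (by decide) h0
    have h2 := step 2 1 (by decide) h1
    have h5 := step 5 1 (by decide) h1
    have h6 := step 6 1 (by decide) h1
    have h3 := step 3 4 (by decide) h4
    have h8 := step 8 4 (by decide) h4
    have h9 := step 9 4 (by decide) h4
    have h7 := step 7 6 (by decide) h6
    intro v
    fin_cases v <;> assumption
  haveI : Nonempty (Fin 10) := ⟨0⟩
  exact ⟨fun a b => (h a).trans (h b).symm⟩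

theorem exG_asc : IsAlmostSelfCentered exG := by
  have hc := exG_connected
  have hV : Fintype.card (Fin 10) = 10 := by simp
  refine ⟨hc, ?_⟩
  have hR := exG_rep
  have i0 := binv_zero hR le_rfl goodD
  have i1 := binv_succ hR le_rfl goodO i0
  have i2 := binv_succ hR le_rfl goodO i1
  have i3 := binv_succ hR le_rfl goodO i2
  have l3 := level_succ hV hc hR i2 (by decide +kernel)
  rw [card_central hV hc hR i3 l3 (by decide +kernel), hV]
  decide +kernel

theorem exG_girth : exG.egirth = (5 : ℕ∞) := by
  apply le_antisymm
  · exact upper_bound _ _ (by simp) exG_asc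
  · rw [le_egirth]
    intro a w hw
    have h3 := hw.three_le_length
    by_contra hlt
    have hlt : w.length < 5 := by
      by_contra h
      exact hlt (by exact_mod_cast (by omega : 5 ≤ w.length))
    have hs : ∀ k < w.length, exG.Adj (w.getVert k) (w.getVert (k + 1)) :=
      fun k hk => w.adj_getVert_succ hk
    have hinj : ∀ a < w.length, ∀ b < w.length, w.getVert a = w.getVert b → a = b := by
      intro a ha b hb h
      exact hw.getVert_injOn' (by simp only [Set.mem_ofPred_eq]; omega)
        (by simp only [Set.mem_ofPred_eq]; omega) h
    have hl : w.getVert w.length = w.getVert 0 := by simp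
    have t3 : ∀ a b c : Fin 10, exG.Adj a b → exG.Adj b c → ¬ exG.Adj c a := by decide +kernel
    have t4 : ∀ a b, exG.Adj a b → ∀ c, exG.Adj b c → a ≠ c → ∀ d, exG.Adj c d → exG.Adj d a →
      b = d := by decide +kernel
    generalize w.length = g at *
    interval_cases g
    · have s2 := hs 2 (by omega)
      rw [hl] at s2
      exact t3 _ _ _ (hs 0 (by omega)) (hs 1 (by omega)) s2
    · have s3 := hs 3 (by omega)
      rw [hl] at s3
      have := t4 _ _ (hs 0 (by omega)) _ (hs 1 (by omega))
        (fun h => by have := hinj 0 (by omega) 2 (by omega) h; omega) _ (hs 2 (by omega)) s3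
      have := hinj 1 (by omega) 3 (by omega) this
      omega

theorem max_girth_almostSelfCentered_order_ten :
    (∀ (V : Type) [Fintype V] (G : SimpleGraph V), Fintype.card V = 10 →
      IsAlmostSelfCentered G → G.egirth ≤ (5 : ℕ∞)) ∧
    (∃ G : SimpleGraph (Fin 10), IsAlmostSelfCentered G ∧ G.egirth = (5 : ℕ∞)) := by
  exact ⟨fun V _ G hV hS => upper_bound V G hV hS, exG, exG_asc, exG_girth⟩
end

section
/- For every integer n ≥ 7 and every integer Δ with either Δ = n − 1 or 3 ≤ Δ ≤ n − 4, there exists an almost peripheral graph of order n with maximum degree Δ. -/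
open SimpleGraph

/-- The maximum degree of a graph. -/
noncomputable def graphMaxDeg {V : Type*} [Fintype V] (G : SimpleGraph V) : ℕ :=
  Finset.univ.sup fun v => (G.neighborSet v).ncard


namespace APG

/-- There is a walk of length at most `k` from `u` to `v`. -/
def Near {V : Type*} (G : SimpleGraph V) (k : ℕ) (u v : V) : Prop :=
  ∃ p : G.Walk u v, p.length ≤ k

/-- Every walk from `u` to `v` has length at least `k`. -/
def Far {V : Type*} (G : SimpleGraph V) (k : ℕ) (u v : V) : Prop :=
  ∀ p : G.Walk u v, k ≤ p.length

theorem Near.mono {V : Type*} {G : SimpleGraph V} {k l : ℕ} {u v : V} (h : Near G k u v)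
    (hkl : k ≤ l) : Near G l u v := by
  obtain ⟨p, hp⟩ := h
  exact ⟨p, hp.trans hkl⟩

theorem Near.refl {V : Type*} {G : SimpleGraph V} (k : ℕ) (u : V) : Near G k u u :=
  ⟨SimpleGraph.Walk.nil, by simp⟩

theorem Near.symm {V : Type*} {G : SimpleGraph V} {k : ℕ} {u v : V} (h : Near G k u v) :
    Near G k v u := by
  obtain ⟨p, hp⟩ := h
  exact ⟨p.reverse, by simpa using hp⟩

theorem Near.trans {V : Type*} {G : SimpleGraph V} {k l : ℕ} {u v w : V} (h : Near G k u v)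
    (h' : Near G l v w) : Near G (k + l) u w := by
  obtain ⟨p, hp⟩ := h
  obtain ⟨q, hq⟩ := h'
  exact ⟨p.append q, by rw [SimpleGraph.Walk.length_append]; omega⟩

theorem Near.of_adj {V : Type*} {G : SimpleGraph V} {u v : V} (h : G.Adj u v) : Near G 1 u v :=
  ⟨SimpleGraph.Walk.cons h SimpleGraph.Walk.nil, by simp⟩

theorem core {n : ℕ} (H : SimpleGraph (Fin n)) (c : Fin n) (d : ℕ)
    (hne : ∃ v, v ≠ c) (hd : 1 ≤ d)
    (near : ∀ u v, Near H d u v) (nearc : ∀ v, Near H (d - 1) c v)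
    (far : ∀ v, v ≠ c → ∃ u, Far H d v u) : IsAlmostPeripheral H := by
  have hn : Nonempty (Fin n) := ⟨c⟩
  have hconn : H.Connected := by
    refine ⟨fun u v => ?_⟩
    obtain ⟨p, -⟩ := near u v
    exact ⟨p⟩
  have hdist : ∀ u v k, Near H k u v → H.dist u v ≤ k := by
    rintro u v k ⟨p, hp⟩
    exact (SimpleGraph.dist_le p).trans hp
  have hcc : graphEcc H c ≤ d - 1 := by
    unfold graphEcc
    exact Finset.sup_le fun u _ => hdist _ _ _ (nearc u)
  have hecc : ∀ v, v ≠ c → graphEcc H v = d := by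
    intro v hv
    apply le_antisymm
    · unfold graphEcc
      exact Finset.sup_le fun u _ => hdist _ _ _ (near v u)
    · obtain ⟨u, hu⟩ := far v hv
      obtain ⟨p, hp⟩ := hconn.exists_walk_length_eq_dist v u
      have h1 := hu p
      rw [hp] at h1
      exact h1.trans (Finset.le_sup (f := fun u => H.dist v u) (Finset.mem_univ u))
  have hdiam : graphDiam H = d := by
    apply le_antisymm
    · unfold graphDiam
      refine Finset.sup_le fun v _ => ?_
      by_cases hv : v = c
      · subst hv; omega
      · exact (hecc v hv).le
    · obtain ⟨v, hv⟩ := hne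
      rw [← hecc v hv]
      exact Finset.le_sup (f := graphEcc H) (Finset.mem_univ v)
  refine ⟨hconn, ?_⟩
  have hset : {v : Fin n | graphEcc H v = graphDiam H} = {c}ᶜ := by
    ext v
    simp only [Set.mem_ofPred_eq, Set.mem_compl_iff, Set.mem_singleton_iff, hdiam]
    constructor
    · rintro h rfl; omega
    · exact hecc v
  rw [hset, Nat.card_coe_set_eq, Set.ncard_compl]
  simp

theorem lift_walk {V W : Type*} (G : SimpleGraph V) (f : W → V) (hf : Function.Surjective f)
    {u v : V} (p : G.Walk u v) : ∀ a b, f a = u → f b = v → (u = v → a = b) ∨ 0 < p.length →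
      Near (G.comap f) p.length a b := by
  induction p with
  | nil =>
    intro a b _ _ h
    rcases h with h | h
    · rw [h rfl]; exact Near.refl _ _
    · simp at h
  | @cons u x v h p ih =>
    intro a b ha hb _
    rw [SimpleGraph.Walk.length_cons]
    by_cases hp : 0 < p.length
    · obtain ⟨y, hy⟩ := hf x
      have h1 := ih y b hy hb (Or.inr hp)
      have h2 : (G.comap f).Adj a y := by simpa [ha, hy] using h
      exact ((Near.of_adj h2).trans h1).mono (by omega)
    · have hxv : x = v := SimpleGraph.Walk.eq_of_length_eq_zero (p := p) (by omega)
      have h2 : (G.comap f).Adj a b := by simpa [ha, hb, ← hxv] using h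
      exact (Near.of_adj h2).mono (by omega)

theorem base_blow {V : Type*} [Fintype V] [DecidableEq V] (G : SimpleGraph V)
    [DecidableRel G.Adj] (c : V) (d : ℕ) (hd : 2 ≤ d) (hne : ∃ v, v ≠ c)
    (near : ∀ u v, Near G d u v) (nearc : ∀ v, Near G (d - 1) c v)
    (far : ∀ v, v ≠ c → ∃ u, Far G d v u)
    (w : V → ℕ) (hw : ∀ v, 1 ≤ w v) (hwc : w c = 1) (D n : ℕ)
    (hle : ∀ v, ∑ u, (if G.Adj v u then w u else 0) ≤ D)
    (hge : D ≤ ∑ u, (if G.Adj c u then w u else 0)) (hn : ∑ v, w v = n) :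
    ∃ H : SimpleGraph (Fin n), IsAlmostPeripheral H ∧ graphMaxDeg H = D := by
  have e : Fin n ≃ (Σ v : V, Fin (w v)) := by
    apply Fintype.equivOfCardEq
    simp [hn]
  set f : Fin n → V := fun i => (e i).1 with hfdef
  have hf : Function.Surjective f := by
    intro v
    refine ⟨e.symm ⟨v, ⟨0, hw v⟩⟩, ?_⟩
    simp [hfdef]
  obtain ⟨c', hc'⟩ := hf c
  have hfib : ∀ a b, f a = c → f b = c → a = b := by
    intro a b ha hb
    apply e.injective
    have ha' : (e a).1 = c := ha
    have hb' : (e b).1 = c := hb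
    generalize e a = x at *
    generalize e b = y at *
    obtain ⟨x1, x2⟩ := x
    obtain ⟨y1, y2⟩ := y
    simp only at ha' hb'
    subst ha'
    subst hb'
    have : x2 = y2 := by apply Fin.ext; omega
    rw [this]
  have hdeg : ∀ a, ((G.comap f).neighborSet a).ncard
      = ∑ u, (if G.Adj (f a) u then w u else 0) := by
    intro a
    have h1 : (G.comap f).neighborSet a
        = ((Finset.univ.filter fun b => G.Adj (f a) (f b) : Finset (Fin n)) : Set (Fin n)) := by
      ext b; simp
    rw [h1, Set.ncard_coe_finset, Finset.card_filter]
    rw [← Equiv.sum_comp e.symm, Fintype.sum_sigma]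
    refine Finset.sum_congr rfl fun u _ => ?_
    simp [hfdef]
  refine ⟨G.comap f, core _ c' d ?_ (by omega) ?_ ?_ ?_, ?_⟩
  · obtain ⟨v, hv⟩ := hne
    obtain ⟨a, ha⟩ := hf v
    exact ⟨a, by rintro rfl; exact hv (ha.symm.trans hc')⟩
  · intro a b
    by_cases hab : f a = f b
    · by_cases hac : f a = c
      · rw [hfib a b hac (hab ▸ hac)]; exact Near.refl _ _
      · obtain ⟨p, -⟩ := near (f a) c
        cases p with
        | nil => exact absurd rfl hac
        | @cons _ x _ h q =>
          obtain ⟨y, hy⟩ := hf x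
          have h1 : (G.comap f).Adj a y := by simpa [hy] using h
          have h2 : (G.comap f).Adj b y := by simpa [hy, ← hab] using h
          exact ((Near.of_adj h1).trans (Near.of_adj h2).symm).mono hd
    · obtain ⟨p, hp⟩ := near (f a) (f b)
      exact (lift_walk G f hf p a b rfl rfl (Or.inl fun h => absurd h hab)).mono hp
  · intro b
    obtain ⟨p, hp⟩ := nearc (f b)
    exact (lift_walk G f hf p c' b hc' rfl
      (Or.inl fun h => hfib _ _ hc' h.symm)).mono hp
  · intro a ha
    obtain ⟨u, hu⟩ := far (f a) (fun h => ha (hfib _ _ h hc'))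
    obtain ⟨b, rfl⟩ := hf u
    refine ⟨b, fun p => ?_⟩
    have := hu (p.map (SimpleGraph.Hom.comap f G))
    exact this.trans_eq (SimpleGraph.Walk.length_map _ _)
  · unfold graphMaxDeg
    apply le_antisymm
    · exact Finset.sup_le fun a _ => by rw [hdeg]; exact hle _
    · refine le_trans ?_ (Finset.le_sup (Finset.mem_univ c'))
      rw [hdeg, hc']; exact hge

/-! ### Small graphs, given by neighbour lists -/

/-- Neighbours of `i` in the table `T`. -/
def nb (T : List (List ℕ)) (i : ℕ) : List ℕ := T.getD i []

/-- Is `b` within distance `k` of `a`? -/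
def ball (T : List (List ℕ)) : ℕ → ℕ → ℕ → Bool
  | 0, a, b => Nat.beq a b
  | k + 1, a, b => Nat.beq a b || (nb T a).any fun x => ball T k x b

/-- The graph of a table. -/
def tgraph (T : List (List ℕ)) (m : ℕ) : SimpleGraph (Fin m) where
  Adj a b := a ≠ b ∧ b.val ∈ nb T a.val ∧ a.val ∈ nb T b.val
  symm := ⟨fun _ _ h => ⟨h.1.symm, h.2.2, h.2.1⟩⟩
  loopless := ⟨fun _ h => h.1 rfl⟩

/-- The checks making a table usable. -/
def Good (T : List (List ℕ)) (m d δ : ℕ) : Prop :=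
  (∀ a < m, ∀ b ∈ nb T a, b < m ∧ b ≠ a ∧ a ∈ nb T b) ∧
  (∀ a < m, ∀ b < m, ball T d a b = true) ∧
  (∀ b < m, ball T (d - 1) 0 b = true) ∧
  (∀ a < m, a ≠ 0 → ∃ b < m, ball T (d - 1) a b = false) ∧
  (∀ a < m, (nb T a).length ≤ δ) ∧ (nb T 0).length = δ ∧ (nb T 0).Nodup ∧ 2 ≤ m ∧ 2 ≤ d ∧ 1 ≤ δ

instance (T : List (List ℕ)) (m d δ : ℕ) : Decidable (Good T m d δ) := by
  unfold Good; infer_instance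

theorem near_of_ball (T : List (List ℕ)) (m : ℕ)
    (h1 : ∀ a < m, ∀ b ∈ nb T a, b < m ∧ b ≠ a ∧ a ∈ nb T b) (k : ℕ) :
    ∀ a b : Fin m, ball T k a b = true → Near (tgraph T m) k a b := by
  induction k with
  | zero =>
    intro a b h
    have : a = b := Fin.ext (Nat.eq_of_beq_eq_true h)
    rw [this]; exact Near.refl _ _
  | succ k ih =>
    intro a b h
    simp only [ball, Bool.or_eq_true, List.any_eq_true] at h
    rcases h with h | ⟨x, hx, h⟩
    · have : a = b := Fin.ext (Nat.eq_of_beq_eq_true h)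
      rw [this]; exact Near.refl _ _
    · obtain ⟨hxm, hxa, hax⟩ := h1 a a.isLt x hx
      have hadj : (tgraph T m).Adj a ⟨x, hxm⟩ :=
        ⟨fun h => hxa (by rw [h]), hx, hax⟩
      exact ((Near.of_adj hadj).trans (ih ⟨x, hxm⟩ b h)).mono (by omega)

theorem ball_of_walk (T : List (List ℕ)) (m : ℕ) {a b : Fin m} (p : (tgraph T m).Walk a b) :
    ∀ k, p.length ≤ k → ball T k a b = true := by
  induction p with
  | nil => intro k _; cases k <;> simp [ball]
  | @cons u x v h p ih =>
    intro k hk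
    rw [SimpleGraph.Walk.length_cons] at hk
    obtain ⟨k, rfl⟩ : ∃ l, k = l + 1 := ⟨k - 1, by omega⟩
    simp only [ball, Bool.or_eq_true, List.any_eq_true]
    exact Or.inr ⟨x, h.2.1, ih k (by omega)⟩

theorem small (T : List (List ℕ)) (m d δ k : ℕ) (hT : Good T m d δ) :
    ∃ H : SimpleGraph (Fin (m + k)), IsAlmostPeripheral H ∧ graphMaxDeg H = δ + k := by
  classical
  obtain ⟨h1, h2, h3, h4, h5, h6, h7, h8, h9, h10⟩ := hT
  obtain ⟨x, hx⟩ : ∃ x, x ∈ nb T 0 := List.exists_mem_of_length_pos (by omega)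
  obtain ⟨hxm, hx0, hx'⟩ := h1 0 (by omega) x hx
  have hsum : ∀ v : Fin m, ∑ u, (if (tgraph T m).Adj v u then
      (1 + if u = ⟨x, hxm⟩ then k else 0) else 0) =
      (Finset.univ.filter fun u => (tgraph T m).Adj v u).card
        + if (tgraph T m).Adj v ⟨x, hxm⟩ then k else 0 := by
    intro v
    rw [Finset.card_filter, ← Finset.sum_filter, Finset.sum_add_distrib]
    congr 1
    · simp
    · rw [Finset.sum_ite_eq']; simp
  have hcard : ∀ v : Fin m, (Finset.univ.filter fun u => (tgraph T m).Adj v u).map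
      Fin.valEmbedding = (nb T v).toFinset := by
    intro v
    ext y
    simp only [Finset.mem_map, Finset.mem_filter, Finset.mem_univ, true_and, List.mem_toFinset,
      Fin.valEmbedding_apply]
    constructor
    · rintro ⟨u, hu, rfl⟩; exact hu.2.1
    · intro hy
      obtain ⟨a, b, c⟩ := h1 v v.isLt y hy
      exact ⟨⟨y, a⟩, ⟨fun h => b (by rw [h]), hy, c⟩, rfl⟩
  refine base_blow (tgraph T m) ⟨0, by omega⟩ d h9 ⟨⟨1, by omega⟩, by simp⟩ ?_ ?_ ?_
    (fun u => 1 + if u = ⟨x, hxm⟩ then k else 0) ?_ ?_ _ _ ?_ ?_ ?_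
  · exact fun u v => near_of_ball T m h1 d u v (h2 u u.isLt v v.isLt)
  · exact fun v => near_of_ball T m h1 _ _ v (h3 v v.isLt)
  · intro v hv
    obtain ⟨b, hb, hvb⟩ := h4 v v.isLt (fun h => hv (Fin.ext h))
    refine ⟨⟨b, hb⟩, fun p => ?_⟩
    by_contra hlt
    have := ball_of_walk T m p (d - 1) (by omega)
    simp only at this
    rw [hvb] at this
    cases this
  · intro v; omega
  · simp; intro h; omega
  · intro v
    rw [hsum, ← Finset.card_map Fin.valEmbedding, hcard]
    have := (nb T v).toFinset_card_le
    have := h5 v v.isLt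
    split_ifs <;> omega
  · rw [hsum, ← Finset.card_map Fin.valEmbedding, hcard]
    rw [List.toFinset_card_of_nodup h7, h6, if_pos]
    exact ⟨fun h => hx0 (by simpa using h.symm), hx, hx'⟩
  · rw [Finset.sum_add_distrib]; simp

theorem good3_1 : Good [[1, 2], [0], [0]]
    3 2 2 := by decide +kernel

theorem good7_2 : Good [[1, 3, 6], [0, 4, 5], [3, 6], [0, 2, 4], [1, 3], [1, 6], [0, 2, 5]]
    7 3 3 := by decide +kernel

theorem good8_2 : Good [[2, 3, 7], [3, 7], [0, 4, 5], [0, 1, 6], [2, 6], [2, 7], [3, 4], [0, 1, 5]]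
    8 3 3 := by decide +kernel

theorem good9_2 : Good [[1, 5, 7], [0, 3, 6], [4, 7, 8], [1, 8], [2, 5, 6], [0, 4], [1, 4], [0, 2, 8], [2, 3, 7]]
    9 3 3 := by decide +kernel

theorem good10_2 : Good [[4, 5, 8], [7, 8], [3, 4, 9], [2, 8], [0, 2, 6], [0, 7, 9], [4, 7, 9], [1, 5, 6], [0, 1, 3], [2, 5, 6]]
    10 3 3 := by decide +kernel

theorem good11_3 : Good [[2, 8, 9], [5, 10], [0, 5, 10], [6, 9], [7, 10], [1, 2, 9], [3, 7], [4, 6, 8], [0, 7], [0, 3, 5], [1, 2, 4]]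
    11 4 3 := by decide +kernel

theorem good12_3 : Good [[1, 3, 9], [0, 2], [1, 10, 11], [0, 6], [8, 9], [6, 8], [3, 5, 11], [9, 10], [4, 5], [0, 4, 7], [2, 7], [2, 6]]
    12 4 3 := by decide +kernel

theorem good13_3 : Good [[2, 5, 6], [3, 5, 9], [0, 8, 12], [1, 8], [7, 10, 12], [0, 1, 11], [0, 7, 11], [4, 6, 10], [2, 3], [1, 10], [4, 7, 9], [5, 6], [2, 4]]
    13 4 3 := by decide +kernel

theorem good14_3 : Good [[1, 6, 7], [0, 4, 8], [3, 6, 11], [2, 5, 10], [1, 9], [3, 12], [0, 2], [0, 9, 12], [1, 11], [4, 7, 13], [3, 12, 13], [2, 8], [5, 7, 10], [9, 10]]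
    14 4 3 := by decide +kernel

theorem good15_3 : Good [[2, 3, 11], [5, 8, 14], [0, 4, 7], [0, 6, 12], [2, 7, 10], [1, 6, 9], [3, 5, 9], [2, 4, 13], [1, 11, 14], [5, 6, 12], [4, 12, 13], [0, 8], [3, 9, 10], [7, 10, 14], [1, 8, 13]]
    15 4 3 := by decide +kernel

theorem good16_3 : Good [[1, 4, 15], [0, 7, 12], [8, 9, 13], [4, 12, 13], [0, 3, 5], [4, 6, 11], [5, 7, 12], [1, 6, 14], [2, 9, 15], [2, 8, 10], [9, 14], [5, 13], [1, 3, 6], [2, 3, 11], [7, 10, 15], [0, 8, 14]]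
    16 4 3 := by decide +kernel

theorem good17_3 : Good [[7, 12, 14], [3, 4, 10], [4, 8, 11], [1, 5, 16], [1, 2, 14], [3, 7, 15], [10, 12, 13], [0, 5, 11], [2, 9, 14], [8, 13], [1, 6], [2, 7], [0, 6, 16], [6, 9, 15], [0, 4, 8], [5, 13], [3, 12]]
    17 4 3 := by decide +kernel

theorem good18_3 : Good [[1, 12, 17], [0, 4, 16], [3, 14, 17], [2, 11, 13], [1, 5, 7], [4, 9, 17], [8, 10, 16], [4, 15], [6, 9, 11], [5, 8, 14], [6, 15, 16], [3, 8, 12], [0, 11, 13], [3, 12, 15], [2, 9], [7, 10, 13], [1, 6, 10], [0, 2, 5]]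
    18 4 3 := by decide +kernel


/-! ### The infinite family: a cycle `0, …, 2r-1` and a path `2r, …, 4r-2`, joined by three edges -/

/-- Directed edges of the family. -/
def FE (r a b : ℕ) : Prop :=
  (b = a + 1 ∧ b ≠ 2 * r) ∨ (a = 0 ∧ b = 2 * r - 1) ∨ (a = 1 ∧ b = 2 * r) ∨
    (a = r ∧ b = 3 * r - 1) ∨ (a = 2 * r - 1 ∧ b = 4 * r - 2)

/-- The family. -/
def fam (r : ℕ) : SimpleGraph (Fin (4 * r - 1)) where
  Adj a b := a ≠ b ∧ (FE r a b ∨ FE r b a)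
  symm := ⟨fun _ _ h => ⟨h.1.symm, h.2.symm⟩⟩
  loopless := ⟨fun _ h => h.1 rfl⟩

/-- Walks of length at most `k`, for vertices given as natural numbers. -/
def NN (r k a b : ℕ) : Prop :=
  ∀ (ha : a < 4 * r - 1) (hb : b < 4 * r - 1), Near (fam r) k ⟨a, ha⟩ ⟨b, hb⟩

theorem NN.symm {r k a b : ℕ} (h : NN r k a b) : NN r k b a :=
  fun ha hb => (h hb ha).symm

theorem NN.trans {r k l a b c : ℕ} (h : NN r k a b) (hb : b < 4 * r - 1) (h' : NN r l b c) :
    NN r (k + l) a c :=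
  fun ha hc => (h ha hb).trans (h' hb hc)

theorem NN.mono {r k l a b : ℕ} (h : NN r k a b) (hkl : k ≤ l) : NN r l a b :=
  fun ha hb => (h ha hb).mono hkl

theorem NN.edge {r a b : ℕ} (h : FE r a b) (hab : a ≠ b) : NN r 1 a b :=
  fun _ _ => Near.of_adj ⟨fun h => hab (by simpa using h), Or.inl h⟩

theorem NN.run {r a : ℕ} (k : ℕ) (h : a + k < 2 * r ∨ 2 * r ≤ a) : NN r k a (a + k) := by
  induction k with
  | zero => exact fun _ _ => Near.refl _ _
  | succ k ih =>
    intro ha hb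
    exact (ih (by omega)).trans (b := a + k) (by omega)
      (NN.edge (b := a + (k + 1)) (Or.inl ⟨by omega, by omega⟩) (by omega)) ha hb

theorem NN.row {r a b : ℕ} (h : (a < 2 * r ∧ b < 2 * r) ∨ (2 * r ≤ a ∧ 2 * r ≤ b)) :
    NN r (a - b + (b - a)) a b := by
  rcases le_total a b with hab | hab
  · obtain ⟨k, rfl⟩ := Nat.exists_eq_add_of_le hab
    exact (NN.run k (by omega)).mono (by omega)
  · obtain ⟨k, rfl⟩ := Nat.exists_eq_add_of_le hab
    exact (NN.run k (by omega)).symm.mono (by omega)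

theorem NN.bot {r a b : ℕ} (hr : 2 ≤ r) (hab : a ≤ b) (hb : b < 2 * r) :
    NN r (a + 2 * r - b) a b := by
  have h1 : NN r 1 0 (2 * r - 1) := NN.edge (Or.inr (Or.inl ⟨rfl, rfl⟩)) (by omega)
  have h0 : NN r (a - 0 + (0 - a)) a 0 := NN.row (by omega)
  have h2 : NN r (2 * r - 1 - b + (b - (2 * r - 1))) (2 * r - 1) b := NN.row (by omega)
  exact ((h0.trans (by omega) h1).trans (by omega) h2).mono (by omega)

/-- Distance bound on the bottom cycle. -/
theorem NN.cyc {r a b k : ℕ} (hr : 2 ≤ r) (ha : a < 2 * r) (hb : b < 2 * r)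
    (hk : (a - b + (b - a) ≤ k) ∨ (2 * r ≤ k + (a - b + (b - a)))) : NN r k a b := by
  rcases hk with hk | hk
  · exact (NN.row (by omega)).mono hk
  · rcases le_total a b with hab | hab
    · exact (NN.bot hr hab hb).mono (by omega)
    · exact (NN.bot hr hab ha).symm.mono (by omega)

/-- Bottom to top, through one of the three rungs. -/
theorem NN.rung {r a b k s t : ℕ} (hr : 2 ≤ r) (ha : a < 2 * r) (hb : 2 * r ≤ b)
    (hst : (s = 1 ∧ t = 2 * r) ∨ (s = r ∧ t = 3 * r - 1) ∨ (s = 2 * r - 1 ∧ t = 4 * r - 2))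
    (hk : (a - s + (s - a)) + 1 + (t - b + (b - t)) ≤ k ∨
      2 * r + 1 + (t - b + (b - t)) ≤ k + (a - s + (s - a))) : NN r k a b := by
  have h1 : NN r 1 s t := NN.edge (Or.inr (Or.inr hst)) (by omega)
  have h2 : NN r (t - b + (b - t)) t b := NN.row (by omega)
  rcases hk with hk | hk
  · have h0 : NN r (a - s + (s - a)) a s := NN.row (by omega)
    exact ((h0.trans (by omega) h1).trans (by omega) h2).mono (by omega)
  · have h0 : NN r (2 * r - (a - s + (s - a))) a s := NN.cyc hr ha (by omega) (by omega)
    exact ((h0.trans (by omega) h1).trans (by omega) h2).mono (by omega)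

theorem NN.bt {r a b : ℕ} (hr : 2 ≤ r) (ha : a < 2 * r) (hb : 2 * r ≤ b) (hb' : b < 4 * r - 1) :
    NN r (r + 1) a b := by
  by_cases h1 : (a - 1 + (1 - a)) + 1 + (2 * r - b + (b - 2 * r)) ≤ r + 1 ∨
      2 * r + 1 + (2 * r - b + (b - 2 * r)) ≤ r + 1 + (a - 1 + (1 - a))
  · exact NN.rung hr ha hb (Or.inl ⟨rfl, rfl⟩) h1
  by_cases h2 : (a - r + (r - a)) + 1 + (3 * r - 1 - b + (b - (3 * r - 1))) ≤ r + 1 ∨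
      2 * r + 1 + (3 * r - 1 - b + (b - (3 * r - 1))) ≤ r + 1 + (a - r + (r - a))
  · exact NN.rung hr ha hb (Or.inr (Or.inl ⟨rfl, rfl⟩)) h2
  refine NN.rung hr ha hb (Or.inr (Or.inr ⟨rfl, rfl⟩)) ?_
  omega

theorem NN.tt {r a b : ℕ} (hr : 2 ≤ r) (ha : 2 * r ≤ a) (hab : a ≤ b) (hb' : b < 4 * r - 1) :
    NN r (r + 1) a b := by
  by_cases h : b ≤ a + r + 1
  · exact (NN.row (by omega)).mono (by omega)
  · have h1 : NN r (a - 2 * r + 1) 1 a :=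
      NN.rung hr (by omega) ha (Or.inl ⟨rfl, rfl⟩) (by omega)
    have h2 : NN r (4 * r - 2 - b + 3) 1 b :=
      NN.rung hr (by omega) (by omega) (Or.inr (Or.inr ⟨rfl, rfl⟩)) (by omega)
    exact (h1.symm.trans (by omega) h2).mono (by omega)

theorem fam_near {r : ℕ} (hr : 2 ≤ r) (u v : Fin (4 * r - 1)) : Near (fam r) (r + 1) u v := by
  suffices h : NN r (r + 1) u v from h u.isLt v.isLt
  have hu := u.isLt
  have hv := v.isLt
  by_cases h1 : u.val < 2 * r <;> by_cases h2 : v.val < 2 * r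
  · exact NN.cyc hr h1 h2 (by omega)
  · exact NN.bt hr h1 (by omega) hv
  · exact (NN.bt hr h2 (by omega) hu).symm
  · rcases le_total u.val v.val with h | h
    · exact NN.tt hr (by omega) h hv
    · exact (NN.tt hr (by omega) h hu).symm

theorem fam_nearc {r : ℕ} (hr : 2 ≤ r) (hc : r < 4 * r - 1) (v : Fin (4 * r - 1)) :
    Near (fam r) r ⟨r, hc⟩ v := by
  suffices h : NN r r r v from h hc v.isLt
  have hv := v.isLt
  by_cases h2 : v.val < 2 * r
  · exact NN.cyc hr (by omega) h2 (by omega)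
  · exact NN.rung hr (by omega) (by omega) (Or.inr (Or.inl ⟨rfl, rfl⟩)) (by omega)

theorem lip {V : Type*} {G : SimpleGraph V} (f : V → ℕ) (hf : ∀ a b, G.Adj a b → f b ≤ f a + 1)
    {u v : V} (p : G.Walk u v) : f v ≤ f u + p.length := by
  induction p with
  | nil => simp
  | cons h p ih =>
    have := hf _ _ h
    rw [SimpleGraph.Walk.length_cons]
    omega

/-- Column of a vertex. -/
def col (r a : ℕ) : ℕ := if a < 2 * r then a else a - (2 * r - 1)

/-- Distance of two vertices in the full prism. -/
def pd (r a b : ℕ) : ℕ :=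
  min (col r a - col r b + (col r b - col r a)) (2 * r - (col r a - col r b + (col r b - col r a)))
    + if (a < 2 * r ↔ b < 2 * r) then 0 else 1

theorem pd_lip {r x a b : ℕ} (hr : 2 ≤ r) (hx : x < 4 * r - 1) (ha : a < 4 * r - 1)
    (hb : b < 4 * r - 1) (h : FE r a b) : pd r x a ≤ pd r x b + 1 ∧ pd r x b ≤ pd r x a + 1 := by
  have hcx : col r x < 2 * r := by unfold col; split_ifs <;> omega
  have hrow : ((a < 2 * r ↔ b < 2 * r) ∧ (col r b = col r a + 1 ∨
      (col r a = 0 ∧ col r b + 1 = 2 * r))) ∨ col r a = col r b := by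
    unfold FE at h
    unfold col
    split_ifs <;> omega
  have hca : col r a < 2 * r := by unfold col; split_ifs <;> omega
  have hcb : col r b < 2 * r := by unfold col; split_ifs <;> omega
  unfold pd
  generalize col r x = X at *
  generalize col r a = A at *
  generalize col r b = B at *
  rcases hrow with ⟨h1, h2⟩ | h1
  · simp only [h1]
    generalize (if (x < 2 * r ↔ b < 2 * r) then 0 else 1) = q
    rcases h2 with h2 | h2 <;> omega
  · rw [h1]
    split_ifs <;> omega

theorem fam_far {r : ℕ} (hr : 2 ≤ r) (v : Fin (4 * r - 1)) (hv : v.val ≠ r) :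
    ∃ u, Far (fam r) (r + 1) v u := by
  have hv' := v.isLt
  obtain ⟨u, hu, hvu⟩ : ∃ u, u < 4 * r - 1 ∧ r + 1 ≤ pd r v u := by
    by_cases h1 : v.val < r
    · exact ⟨v.val + r + (2 * r - 1), by omega, by unfold pd col; split_ifs <;> omega⟩
    by_cases h2 : v.val < 2 * r
    · exact ⟨v.val - r + (2 * r - 1), by omega, by unfold pd col; split_ifs <;> omega⟩
    by_cases h3 : v.val < 3 * r - 1
    · exact ⟨v.val - (2 * r - 1) + r, by omega, by unfold pd col; split_ifs <;> omega⟩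
    · exact ⟨v.val - (2 * r - 1) - r, by omega, by unfold pd col; split_ifs <;> omega⟩
  refine ⟨⟨u, hu⟩, fun p => ?_⟩
  have h1 := lip (fun y : Fin (4 * r - 1) => pd r v y) (fun a b hab => by
    rcases hab.2 with h | h
    · exact (pd_lip hr hv' a.isLt b.isLt h).2
    · exact (pd_lip hr hv' b.isLt a.isLt h).1) p
  have h0 : pd r v v = 0 := by simp [pd]
  simp only at h1
  omega

theorem card_le_two {m : ℕ} (S : Finset (Fin m)) (p q : ℕ) (h : ∀ u ∈ S, u.val = p ∨ u.val = q) :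
    S.card ≤ 2 := by
  rw [← Finset.card_map Fin.valEmbedding]
  refine (Finset.card_le_card (t := {p, q}) ?_).trans Finset.card_le_two
  intro y hy
  obtain ⟨u, hu, rfl⟩ := Finset.mem_map.1 hy
  simpa using h u hu

theorem card_le_three {m : ℕ} (S : Finset (Fin m)) (p q s : ℕ)
    (h : ∀ u ∈ S, u.val = p ∨ u.val = q ∨ u.val = s) : S.card ≤ 3 := by
  rw [← Finset.card_map Fin.valEmbedding]
  refine (Finset.card_le_card (t := {p, q, s}) ?_).trans Finset.card_le_three
  intro y hy
  obtain ⟨u, hu, rfl⟩ := Finset.mem_map.1 hy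
  simpa using h u hu

theorem large (r j k : ℕ) (hr : 5 ≤ r) (hj : j ≤ 3) :
    ∃ H : SimpleGraph (Fin (4 * r - 1 + j + k)), IsAlmostPeripheral H ∧ graphMaxDeg H = 3 + k := by
  classical
  set a : Fin (4 * r - 1) := ⟨2 * r + 1, by omega⟩ with ha
  set b : Fin (4 * r - 1) := ⟨2 * r + 2, by omega⟩ with hb
  set e : Fin (4 * r - 1) := ⟨4 * r - 3, by omega⟩ with he
  set x : Fin (4 * r - 1) := ⟨3 * r - 1, by omega⟩ with hx
  set c : Fin (4 * r - 1) := ⟨r, by omega⟩ with hc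
  obtain ⟨j1, j2, j3, hj1, hj2, hj3, hjs⟩ :
      ∃ j1 j2 j3 : ℕ, j1 ≤ 1 ∧ j2 ≤ 1 ∧ j3 ≤ 1 ∧ j = j1 + j2 + j3 :=
    ⟨min j 1, min (j - 1) 1, min (j - 2) 1, by omega, by omega, by omega, by omega⟩
  let w : Fin (4 * r - 1) → ℕ := fun u => 1 + (if u = x then k else 0) + (if u = a then j1 else 0)
    + (if u = b then j2 else 0) + (if u = e then j3 else 0)
  have hsum : ∀ v, ∑ u, (if (fam r).Adj v u then w u else 0) =
      (Finset.univ.filter fun u => (fam r).Adj v u).card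
        + (if (fam r).Adj v x then k else 0) + (if (fam r).Adj v a then j1 else 0)
        + (if (fam r).Adj v b then j2 else 0) + (if (fam r).Adj v e then j3 else 0) := by
    intro v
    rw [← Finset.sum_filter]
    simp only [w, Finset.sum_add_distrib, Finset.sum_ite_eq', Finset.mem_filter,
      Finset.mem_univ, true_and, Finset.sum_const, smul_eq_mul, mul_one]
  have hadj : ∀ u v, (fam r).Adj u v → FE r u v ∨ FE r v u := fun u v h => h.2
  have hd3 : ∀ v, (Finset.univ.filter fun u => (fam r).Adj v u).card ≤ 3 := by
    intro v
    have hv := v.isLt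
    by_cases h : v.val < 2 * r
    · refine card_le_three _ (if v.val = 0 then 2 * r - 1 else v.val - 1)
        (if v.val = 2 * r - 1 then 0 else v.val + 1)
        (if v.val = 1 then 2 * r else if v.val = r then 3 * r - 1 else 4 * r - 2) ?_
      intro u hu
      have hu' := u.isLt
      have := hadj _ _ (Finset.mem_filter.1 hu).2
      unfold FE at this
      split_ifs <;> omega
    · refine card_le_three _ (if v.val = 2 * r then 1 else v.val - 1)
        (if v.val = 4 * r - 2 then 2 * r - 1 else v.val + 1) r ?_
      intro u hu
      have hu' := u.isLt
      have := hadj _ _ (Finset.mem_filter.1 hu).2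
      unfold FE at this
      split_ifs <;> omega
  have hd2 : ∀ v : Fin (4 * r - 1), 2 * r ≤ v.val → v.val ≠ 3 * r - 1 →
      (Finset.univ.filter fun u => (fam r).Adj v u).card ≤ 2 := by
    intro v h h'
    have hv := v.isLt
    refine card_le_two _ (if v.val = 2 * r then 1 else v.val - 1)
      (if v.val = 4 * r - 2 then 2 * r - 1 else v.val + 1) ?_
    intro u hu
    have hu' := u.isLt
    have := hadj _ _ (Finset.mem_filter.1 hu).2
    unfold FE at this
    split_ifs <;> omega
  have hna : ∀ v, (fam r).Adj v a → v.val = 2 * r ∨ v.val = 2 * r + 2 := by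
    intro v h
    have := hadj _ _ h
    have hv := v.isLt
    simp only [FE, ha] at this
    omega
  have hnb : ∀ v, (fam r).Adj v b → v.val = 2 * r + 1 ∨ v.val = 2 * r + 3 := by
    intro v h
    have := hadj _ _ h
    have hv := v.isLt
    simp only [FE, hb] at this
    omega
  have hne : ∀ v, (fam r).Adj v e → v.val = 4 * r - 4 ∨ v.val = 4 * r - 2 := by
    intro v h
    have := hadj _ _ h
    have hv := v.isLt
    simp only [FE, he] at this
    omega
  refine base_blow (fam r) c (r + 1) (by omega) ⟨x, ?_⟩ (fam_near (by omega))
    (fam_nearc (by omega) (by omega)) ?_ w ?_ ?_ _ _ ?_ ?_ ?_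
  · simp only [hx, hc, ne_eq, Fin.mk.injEq]; omega
  · intro v hv
    exact fam_far (by omega) v (fun h => hv (Fin.ext h))
  · intro v; simp only [w]; omega
  · simp only [w, hx, hc, ha, hb, he, Fin.mk.injEq]
    split_ifs <;> omega
  · intro v
    rw [hsum]
    have h3 := hd3 v
    have h2 := hd2 v
    have h4 := hna v
    have h5 := hnb v
    have h6 := hne v
    by_cases q1 : (fam r).Adj v a
    · have q2 : ¬ (fam r).Adj v b := fun h => by have := h4 q1; have := h5 h; omega
      have q3 : ¬ (fam r).Adj v e := fun h => by have := h4 q1; have := h6 h; omega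
      have := h2 (by have := h4 q1; omega) (by have := h4 q1; omega)
      rw [if_pos q1, if_neg q2, if_neg q3]
      split_ifs <;> omega
    · by_cases q2 : (fam r).Adj v b
      · have q3 : ¬ (fam r).Adj v e := fun h => by have := h5 q2; have := h6 h; omega
        have := h2 (by have := h5 q2; omega) (by have := h5 q2; omega)
        rw [if_neg q1, if_pos q2, if_neg q3]
        split_ifs <;> omega
      · rw [if_neg q1, if_neg q2]
        by_cases q3 : (fam r).Adj v e
        · have := h2 (by have := h6 q3; omega) (by have := h6 q3; omega)
          rw [if_pos q3]
          split_ifs <;> omega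
        · rw [if_neg q3]
          split_ifs <;> omega
  · rw [hsum]
    have hcx : (fam r).Adj c x := by
      refine ⟨by simp only [hx, hc, ne_eq, Fin.mk.injEq]; omega, Or.inl ?_⟩
      simp [FE, hx, hc]
    rw [if_pos hcx]
    have : 3 ≤ (Finset.univ.filter fun u => (fam r).Adj c u).card := by
      have h3 : ({⟨r - 1, by omega⟩, ⟨r + 1, by omega⟩, x} : Finset (Fin (4 * r - 1))).card = 3 := by
        rw [Finset.card_eq_three]
        refine ⟨_, _, _, ?_, ?_, ?_, rfl⟩ <;> simp only [hx, ne_eq, Fin.mk.injEq] <;> omega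
      rw [← h3]
      apply Finset.card_le_card
      intro y hy
      simp only [Finset.mem_insert, Finset.mem_singleton] at hy
      refine Finset.mem_filter.2 ⟨Finset.mem_univ _, ?_⟩
      rcases hy with rfl | rfl | rfl
      · refine ⟨by simp only [hc, ne_eq, Fin.mk.injEq]; omega, Or.inr (Or.inl ?_)⟩
        change r = r - 1 + 1 ∧ r ≠ 2 * r
        omega
      · refine ⟨by simp only [hc, ne_eq, Fin.mk.injEq]; omega, Or.inl (Or.inl ?_)⟩
        change r + 1 = r + 1 ∧ r + 1 ≠ 2 * r
        omega
      · exact hcx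
    omega
  · simp only [w, Finset.sum_add_distrib, Finset.sum_ite_eq', Finset.mem_univ, if_true,
      Finset.sum_const, Finset.card_univ, Fintype.card_fin, smul_eq_mul, mul_one]
    omega

theorem all_bases (m k : ℕ) (hm : 7 ≤ m) :
    ∃ H : SimpleGraph (Fin (m + k)), IsAlmostPeripheral H ∧ graphMaxDeg H = 3 + k := by
  by_cases h : m ≤ 18
  · interval_cases m
    · exact small _ _ _ _ k good7_2
    · exact small _ _ _ _ k good8_2
    · exact small _ _ _ _ k good9_2
    · exact small _ _ _ _ k good10_2
    · exact small _ _ _ _ k good11_3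
    · exact small _ _ _ _ k good12_3
    · exact small _ _ _ _ k good13_3
    · exact small _ _ _ _ k good14_3
    · exact small _ _ _ _ k good15_3
    · exact small _ _ _ _ k good16_3
    · exact small _ _ _ _ k good17_3
    · exact small _ _ _ _ k good18_3
  · have := large ((m + 1) / 4) ((m + 1) % 4) k (by omega) (by omega)
    have e : 4 * ((m + 1) / 4) - 1 + (m + 1) % 4 = m := by omega
    rwa [e] at this

end APG

theorem exists_almostPeripheral_with_maxDeg (n Δ : ℕ) (h7 : 7 ≤ n)
    (hΔ : Δ = n - 1 ∨ (3 ≤ Δ ∧ Δ ≤ n - 4)) :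
    ∃ G : SimpleGraph (Fin n), IsAlmostPeripheral G ∧ graphMaxDeg G = Δ := by
  rcases hΔ with h | ⟨h1, h2⟩
  · have := APG.small _ _ _ _ (n - 3) APG.good3_1
    have e1 : 3 + (n - 3) = n := by omega
    have e2 : 2 + (n - 3) = Δ := by omega
    rwa [e1, e2] at this
  · have := APG.all_bases (n - Δ + 3) (Δ - 3) (by omega)
    have e1 : n - Δ + 3 + (Δ - 3) = n := by omega
    have e2 : 3 + (Δ - 3) = Δ := by omega
    rwa [e1, e2] at this
end
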